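/- In the chain-plus-loops graph Γ: let r be an integer with 1 ≤ r ≤ g − a − 2 and let D be an effective divisor of degree a + 2r supported on Γ₀ such that rk_Γ(D − P) = r for some point P ∈ γ_{a+1} \ {v_{a+1}}. Then there exists an effective divisor E of degree a − 2 supported on Γ₀ such that D is linearly equivalent on Γ₀ to 2(v_{a+1} + v_{a+2} + ⋯ + v_{a+r+1}) + E. -/

import Mathlib

noncomputable section

/-- The star with `n` rays of radius `r` in the complex plane:
`{ z ∈ ℂ : z = t·e^{2πik/n}, t ∈ [0,r], k ∈ ℤ }`. -/
def starSet (n : ℕ) (r : ℝ) : Set ℂ :=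
  {z | ∃ t ∈ Set.Icc (0 : ℝ) r, ∃ k : ℤ,
    z = (t : ℂ) * Complex.exp (2 * (Real.pi : ℂ) * Complex.I * (k : ℂ) / (n : ℂ))}

/-- `P` has a neighbourhood isometric to a star with `n` rays of some radius `r > 0`,
with `P` corresponding to `0`. -/
def HasStarNbhd (Γ : Type*) [MetricSpace Γ] (P : Γ) (n : ℕ) : Prop :=
  ∃ r > (0 : ℝ), ∃ U ∈ nhds P, ∃ φ : Γ → ℂ,
    φ P = 0 ∧ φ '' U = starSet n r ∧
    ∀ x ∈ U, ∀ y ∈ U, dist (φ x) (φ y) = dist x y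

/-- A metric graph: a compact connected metric space in which every point has a
neighbourhood isometric to a star with `n ≥ 1` rays. -/
def IsMetricGraph (Γ : Type*) [MetricSpace Γ] : Prop :=
  CompactSpace Γ ∧ ConnectedSpace Γ ∧ ∀ P : Γ, ∃ n : ℕ, 1 ≤ n ∧ HasStarNbhd Γ P n

/-- The valence of a point: the number of rays of a star neighbourhood. -/
noncomputable def valence (Γ : Type*) [MetricSpace Γ] (P : Γ) : ℕ :=
  sInf {n : ℕ | 1 ≤ n ∧ HasStarNbhd Γ P n}

/-- A vertex is a point of valence different from `2`. -/
def IsVertex (Γ : Type*) [MetricSpace Γ] (P : Γ) : Prop := valence Γ P ≠ 2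

/-- The genus of a metric graph: `#edges - #vertices + 1`, the edges being the connected
components of the complement of the vertex set. -/
noncomputable def graphGenus (Γ : Type*) [MetricSpace Γ] : ℤ :=
  (Nat.card (ConnectedComponents {P : Γ // ¬ IsVertex Γ P}) : ℤ)
    - (Nat.card {P : Γ // IsVertex Γ P} : ℤ) + 1

/-- A divisor on `Γ` : a finitely supported formal `ℤ`-linear combination of points. -/
abbrev Divisor (Γ : Type*) : Type _ := Γ →₀ ℤ

/-- The degree of a divisor. -/
def divDeg {Γ : Type*} (D : Divisor Γ) : ℤ := D.sum fun _ n => n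

/-- A divisor is effective if all its coefficients are nonnegative. -/
def Effective {Γ : Type*} (D : Divisor Γ) : Prop := ∀ P : Γ, 0 ≤ D P

/-- An arc based at `P` : an isometric parametrization of a segment emanating from `P`. -/
def IsArcAt {Γ : Type*} [MetricSpace Γ] (P : Γ) (τ : ℝ → Γ) : Prop :=
  τ 0 = P ∧ ∃ a > (0 : ℝ), ∀ s ∈ Set.Icc (0 : ℝ) a, ∀ t ∈ Set.Icc (0 : ℝ) a,
    dist (τ s) (τ t) = |s - t|

/-- Two arcs are equivalent (define the same tangent direction) when they agree near `0`. -/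
def ArcEquiv {Γ : Type*} (τ τ' : ℝ → Γ) : Prop :=
  ∃ ε > (0 : ℝ), ∀ t ∈ Set.Icc (0 : ℝ) ε, τ t = τ' t

/-- `f` has (one-sided) slope `s` along the arc `τ`. -/
def HasSlopeAlong {Γ : Type*} (f : Γ → ℝ) (τ : ℝ → Γ) (s : ℤ) : Prop :=
  ∃ ε > (0 : ℝ), ∀ t ∈ Set.Icc (0 : ℝ) ε, f (τ t) = f (τ 0) + (s : ℝ) * t

/-- A rational function on a metric graph: continuous and piecewise affine with
integer slopes, i.e. having an integer slope along every arc. -/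
def IsRational (Γ : Type*) [MetricSpace Γ] (f : Γ → ℝ) : Prop :=
  Continuous f ∧ ∀ (P : Γ) (τ : ℝ → Γ), IsArcAt P τ → ∃ s : ℤ, HasSlopeAlong f τ s

/-- `div f` has coefficient `m` at `P`: the sum of the slopes of `f` in all tangent
directions emanating from `P` equals `m`. -/
def HasOrderAt (Γ : Type*) [MetricSpace Γ] (f : Γ → ℝ) (P : Γ) (m : ℤ) : Prop :=
  ∃ (n : ℕ) (τ : Fin n → ℝ → Γ) (s : Fin n → ℤ),
    (∀ i, IsArcAt P (τ i)) ∧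
    Pairwise (fun i j => ¬ ArcEquiv (τ i) (τ j)) ∧
    (∀ σ : ℝ → Γ, IsArcAt P σ → ∃ i, ArcEquiv σ (τ i)) ∧
    (∀ i, HasSlopeAlong f (τ i) (s i)) ∧
    m = ∑ i, s i

/-- Linear equivalence of divisors: `D₂ - D₁ = div f` for some rational function `f`. -/
def LinEquiv (Γ : Type*) [MetricSpace Γ] (D₁ D₂ : Divisor Γ) : Prop :=
  ∃ f : Γ → ℝ, IsRational Γ f ∧ ∀ P : Γ, HasOrderAt Γ f P (D₂ P - D₁ P)

/-- `D` is linearly equivalent to an effective divisor. -/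
def EquivEffective (Γ : Type*) [MetricSpace Γ] (D : Divisor Γ) : Prop :=
  ∃ D' : Divisor Γ, Effective D' ∧ LinEquiv Γ D D'

/-- For every effective divisor `E` of degree `r`, `D - E` is linearly equivalent to an
effective divisor. -/
def RankGE (Γ : Type*) [MetricSpace Γ] (D : Divisor Γ) (r : ℕ) : Prop :=
  ∀ E : Divisor Γ, Effective E → divDeg E = (r : ℤ) → EquivEffective Γ (D - E)

/-- The rank of a divisor: `-1` if `D` is not equivalent to an effective divisor, and
otherwise the largest `r ≥ 0` such that `D - E` is equivalent to an effective divisor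
for every effective `E` of degree `r`. -/
noncomputable def divRank (Γ : Type*) [MetricSpace Γ] (D : Divisor Γ) : ℤ :=
  sSup (insert (-1) {n : ℤ | ∃ r : ℕ, n = (r : ℤ) ∧ RankGE Γ D r})

/-- The arc `τ` immediately leaves the set `X`. -/
def ArcLeaves {Γ : Type*} (X : Set Γ) (τ : ℝ → Γ) : Prop :=
  ∃ ε > (0 : ℝ), ∀ t ∈ Set.Ioc (0 : ℝ) ε, τ t ∉ X

/-- `P` is a non-saturated boundary point of `X` with respect to `D` : the number of
tangent directions at `P` leaving `X` is strictly greater than `D P`. -/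
def NonSaturated (Γ : Type*) [MetricSpace Γ] (D : Divisor Γ) (X : Set Γ) (P : Γ) : Prop :=
  P ∈ frontier X ∧ ∃ (n : ℕ) (τ : Fin n → ℝ → Γ),
    (∀ i, IsArcAt P (τ i)) ∧ (∀ i, ArcLeaves X (τ i)) ∧
    Pairwise (fun i j => ¬ ArcEquiv (τ i) (τ j)) ∧ D P < (n : ℤ)

/-- `D` is `P₀`-reduced. -/
def IsReducedDivisor (Γ : Type*) [MetricSpace Γ] (D : Divisor Γ) (P₀ : Γ) : Prop :=
  (∀ P : Γ, P ≠ P₀ → 0 ≤ D P) ∧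
  ∀ X : Set Γ, IsClosed X → X.Nonempty → P₀ ∉ X → ∃ P, NonSaturated Γ D X P

/-- The restriction of a divisor on `Γ` to a divisor on a subset `S` (with the induced
metric); divisors supported on `S` are identified with divisors on `S` this way. -/
noncomputable def DivRestrict {Γ : Type*} (S : Set Γ) (D : Divisor Γ) : Divisor ↥S :=
  Finsupp.comapDomain Subtype.val D Subtype.coe_injective.injOn

/-- Linear equivalence computed on the subgraph `S` of `Γ`. -/
def LinEquivOn {Γ : Type*} [MetricSpace Γ] (S : Set Γ) (D₁ D₂ : Divisor Γ) : Prop :=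
  LinEquiv ↥S (DivRestrict S D₁) (DivRestrict S D₂)

/-- The rank computed on the subgraph `S` of `Γ`. -/
noncomputable def divRankOn {Γ : Type*} [MetricSpace Γ] (S : Set Γ) (D : Divisor Γ) : ℤ :=
  divRank ↥S (DivRestrict S D)

/-- A free divisor: effective, of rank at least one, and removing any point decreases
the rank. -/
def IsFreeDivisor (Γ : Type*) [MetricSpace Γ] (D : Divisor Γ) : Prop :=
  Effective D ∧ 1 ≤ divRank Γ D ∧
  ∀ P : Γ, divRank Γ (D - Finsupp.single P 1) < divRank Γ D

/-- The canonical divisor `K_Γ = Σ_P (val(P) - 2)·P`. -/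
def IsCanonical (Γ : Type*) [MetricSpace Γ] (K : Divisor Γ) : Prop :=
  ∀ P : Γ, K P = (valence Γ P : ℤ) - 2

/-- A very special divisor: effective with `rk(D) > 0` and `rk(K_Γ - D) > 0`. -/
def VerySpecial (Γ : Type*) [MetricSpace Γ] (D : Divisor Γ) : Prop :=
  Effective D ∧ 0 < divRank Γ D ∧
  ∃ K : Divisor Γ, IsCanonical Γ K ∧ 0 < divRank Γ (K - D)

/-- `φ` is an `L`-periodic locally isometric parametrization of the circle `S ⊆ Γ`
of circumference `L`. -/
def CircleParam {Γ : Type*} [MetricSpace Γ] (S : Set Γ) (L : ℝ) (φ : ℝ → Γ) : Prop :=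
  0 < L ∧ (∀ t : ℝ, φ (t + L) = φ t) ∧ Set.range φ = S ∧
  ∀ s t : ℝ, |s - t| ≤ L / 2 → dist (φ s) (φ t) = |s - t|

/-- `S` is a metric circle inside `Γ`. -/
def IsCircleSet {Γ : Type*} [MetricSpace Γ] (S : Set Γ) : Prop :=
  ∃ (L : ℝ) (φ : ℝ → Γ), CircleParam S L φ

end
/-- A bundled metric graph. -/
structure MetricGraph : Type 1 where
  carrier : Type
  [ms : MetricSpace carrier]
  graph : IsMetricGraph carrier

attribute [instance] MetricGraph.ms

/-- A metric graph `G` obtained from a metric graph `G₀` by attaching a loop `γ`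
(a metric circle) at a point `v ∈ G₀`. -/
structure LoopAttachment : Type 1 where
  G : Type
  [ms : MetricSpace G]
  graph : IsMetricGraph G
  G₀ : Set G
  γ : Set G
  v : G
  hv : v ∈ G₀
  closed₀ : IsClosed G₀
  closedγ : IsClosed γ
  cover : G₀ ∪ γ = Set.univ
  meet : G₀ ∩ γ = {v}
  graph₀ : IsMetricGraph ↥G₀
  circleγ : IsCircleSet γ

attribute [instance] LoopAttachment.ms
/-- A chain of `a` loops `γ₁, …, γ_a` with consecutive loops meeting in the points
`w₁, …, w_{a-1}`, together with marked points `vg ∈ γ₁ \ {w₁}` and `vg' ∈ γ_a \ {w_{a-1}}`. -/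
structure ChainOfLoops (a : ℕ) : Type 1 where
  ha : 1 ≤ a
  Γ : Type
  [ms : MetricSpace Γ]
  graph : IsMetricGraph Γ
  loop : ℕ → Set Γ
  w : ℕ → Γ
  vg : Γ
  vg' : Γ
  circle : ∀ i ∈ Finset.Icc 1 a, IsCircleSet (loop i)
  closedLoop : ∀ i ∈ Finset.Icc 1 a, IsClosed (loop i)
  cover : (⋃ i ∈ Finset.Icc 1 a, loop i) = Set.univ
  chainMeet : ∀ i ∈ Finset.Icc 1 (a - 1), loop i ∩ loop (i + 1) = {w i}
  chainDisj : ∀ i ∈ Finset.Icc 1 a, ∀ j ∈ Finset.Icc 1 a, i + 2 ≤ j → loop i ∩ loop j = ∅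
  hvg : vg ∈ loop 1
  hvg' : vg' ∈ loop a
  hvgw : 2 ≤ a → vg ≠ w 1
  hvg'w : 2 ≤ a → vg' ≠ w (a - 1)

attribute [instance] ChainOfLoops.ms

/-- The chain-plus-loops graph: a chain `Γ₀` of `a` loops (with the genericity condition
that the two edges joining `w_i` to `w_{i+1}` have different lengths), marked points
`v_{a+1}, …, v_g` on `Γ₀` (with `v_g ∈ γ₁ \ {w₁}`, `2v_g ≁ 2w₁` on `γ₁`, and
`v_{g-1} ∈ γ_a \ {w_{a-1}}`, `2v_{g-1} ≁ 2w_{a-1}` on `γ_a`), and a loop `γ_i`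
attached at `v_i` for each `a + 1 ≤ i ≤ g`. -/
structure ChainPlusLoops (a g : ℕ) : Type 1 where
  ha : 1 ≤ a
  hg : a + 3 ≤ g
  Γ : Type
  [ms : MetricSpace Γ]
  graph : IsMetricGraph Γ
  loop : ℕ → Set Γ
  w : ℕ → Γ
  v : ℕ → Γ
  Γ₀ : Set Γ
  hΓ₀ : Γ₀ = ⋃ i ∈ Finset.Icc 1 a, loop i
  circle : ∀ i ∈ Finset.Icc 1 g, IsCircleSet (loop i)
  closedLoop : ∀ i ∈ Finset.Icc 1 g, IsClosed (loop i)
  chainMeet : ∀ i ∈ Finset.Icc 1 (a - 1), loop i ∩ loop (i + 1) = {w i}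
  chainDisj : ∀ i ∈ Finset.Icc 1 a, ∀ j ∈ Finset.Icc 1 a, i + 2 ≤ j → loop i ∩ loop j = ∅
  edgeLengths : ∀ i ∈ Finset.Icc 1 (a - 2), ∃ (L : ℝ) (φ : ℝ → Γ) (l : ℝ),
    CircleParam (loop (i + 1)) L φ ∧ φ 0 = w i ∧ 0 < l ∧ l < L ∧ φ l = w (i + 1) ∧ 2 * l ≠ L
  cover : Γ₀ ∪ (⋃ i ∈ Finset.Icc (a + 1) g, loop i) = Set.univ
  hvg : v g ∈ loop 1
  hvg' : v (g - 1) ∈ loop a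
  hvgw : 2 ≤ a → v g ≠ w 1
  hvg'w : 2 ≤ a → v (g - 1) ≠ w (a - 1)
  vgGeneric : 2 ≤ a →
    ¬ LinEquivOn (loop 1) (Finsupp.single (v g) 2) (Finsupp.single (w 1) 2)
  vg'Generic : 2 ≤ a →
    ¬ LinEquivOn (loop a) (Finsupp.single (v (g - 1)) 2) (Finsupp.single (w (a - 1)) 2)
  hvMem : ∀ i ∈ Finset.Icc (a + 1) g, v i ∈ Γ₀
  hvInj : ∀ i ∈ Finset.Icc (a + 1) g, ∀ j ∈ Finset.Icc (a + 1) g, i ≠ j → v i ≠ v j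
  hvw : ∀ i ∈ Finset.Icc (a + 1) g, ∀ k ∈ Finset.Icc 1 (a - 1), v i ≠ w k
  attachMeet : ∀ i ∈ Finset.Icc (a + 1) g, loop i ∩ Γ₀ = {v i}
  attachDisj : ∀ i ∈ Finset.Icc (a + 1) g, ∀ j ∈ Finset.Icc (a + 1) g, i ≠ j →
    loop i ∩ loop j = ∅
  graph₀ : IsMetricGraph ↥Γ₀
  hGenus : graphGenus Γ = (g : ℤ)

attribute [instance] ChainPlusLoops.ms

section Slopes

open Set Filter Topology

theorem HasSlopeAlong.unique {Γ : Type*} {f : Γ → ℝ} {τ : ℝ → Γ} {s s' : ℤ}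
    (h : HasSlopeAlong f τ s) (h' : HasSlopeAlong f τ s') : s = s' := by
  obtain ⟨ε, hε, h⟩ := h
  obtain ⟨ε', hε', h'⟩ := h'
  have hm : 0 < min ε ε' := lt_min hε hε'
  have h1 := h (min ε ε') ⟨hm.le, min_le_left _ _⟩
  have h2 := h' (min ε ε') ⟨hm.le, min_le_right _ _⟩
  have h3 : (s : ℝ) * min ε ε' = s' * min ε ε' := by linarith
  exact_mod_cast mul_right_cancel₀ hm.ne' h3

theorem HasSlopeAlong.congr_arc {Γ : Type*} {f : Γ → ℝ} {τ τ' : ℝ → Γ} {s : ℤ}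
    (h : HasSlopeAlong f τ s) (hτ : ArcEquiv τ τ') : HasSlopeAlong f τ' s := by
  obtain ⟨ε, hε, h⟩ := h
  obtain ⟨ε', hε', h'⟩ := hτ
  refine ⟨min ε ε', lt_min hε hε', fun t ht => ?_⟩
  rw [← h' t ⟨ht.1, ht.2.trans (min_le_right _ _)⟩, ← h' 0 ⟨le_rfl, hε'.le⟩]
  exact h t ⟨ht.1, ht.2.trans (min_le_left _ _)⟩

theorem ArcEquiv.symm {Γ : Type*} {τ τ' : ℝ → Γ} (h : ArcEquiv τ τ') : ArcEquiv τ' τ := by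
  obtain ⟨ε, hε, h⟩ := h
  exact ⟨ε, hε, fun t ht => (h t ht).symm⟩

theorem ArcEquiv.trans {Γ : Type*} {τ τ' τ'' : ℝ → Γ} (h : ArcEquiv τ τ')
    (h' : ArcEquiv τ' τ'') : ArcEquiv τ τ'' := by
  obtain ⟨ε, hε, h⟩ := h
  obtain ⟨ε', hε', h'⟩ := h'
  exact ⟨min ε ε', lt_min hε hε', fun t ht =>
    (h t ⟨ht.1, ht.2.trans (min_le_left _ _)⟩).trans (h' t ⟨ht.1, ht.2.trans (min_le_right _ _)⟩)⟩

/-- The coefficient of `div f` at a point is unique. -/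
theorem HasOrderAt.unique {Γ : Type*} [MetricSpace Γ] {f : Γ → ℝ} {P : Γ} {m m' : ℤ}
    (h : HasOrderAt Γ f P m) (h' : HasOrderAt Γ f P m') : m = m' := by
  obtain ⟨n, τ, s, harc, hpw, hex, hs, rfl⟩ := h
  obtain ⟨n', τ', s', harc', hpw', hex', hs', rfl⟩ := h'
  choose e he using fun i => hex' (τ i) (harc i)
  have hinj : Function.Injective e := by
    intro i j hij
    by_contra hne
    exact hpw hne ((he i).trans (hij ▸ (he j).symm))
  have hsurj : Function.Surjective e := by
    intro j
    obtain ⟨i, hi⟩ := hex (τ' j) (harc' j)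
    refine ⟨i, ?_⟩
    by_contra hne
    exact hpw' hne ((he i).symm.trans hi.symm)
  refine Fintype.sum_bijective e ⟨hinj, hsurj⟩ _ _ fun i => ?_
  exact ((hs i).congr_arc (he i)).unique (hs' (e i))

open Classical in
/-- The integer slope of `h` immediately to the right of `0` (`0` if there is none). -/
noncomputable def germSlope (h : ℝ → ℝ) : ℤ :=
  if hs : ∃ s : ℤ, HasSlopeAlong h (fun u => u) s then hs.choose else 0

/-- The slope of `h` at `t` in the positive direction. -/
noncomputable def rightSlope (h : ℝ → ℝ) (t : ℝ) : ℤ := germSlope fun u => h (t + u)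

/-- The slope of `h` at `t` in the negative direction. -/
noncomputable def leftSlope (h : ℝ → ℝ) (t : ℝ) : ℤ := germSlope fun u => h (t - u)

/-- The change of slope of `h` at `t`. -/
noncomputable def kink (h : ℝ → ℝ) (t : ℝ) : ℤ := rightSlope h t + leftSlope h t

/-- `h` is piecewise affine with integer slopes. -/
def PiecewiseAffine (h : ℝ → ℝ) : Prop :=
  ∀ t, (∃ s : ℤ, HasSlopeAlong h (fun u => t + u) s) ∧ ∃ s : ℤ, HasSlopeAlong h (fun u => t - u) s

theorem germSlope_eq {h : ℝ → ℝ} {s : ℤ} (hs : HasSlopeAlong h (fun u => u) s) :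
    germSlope h = s := by
  have hex : ∃ s : ℤ, HasSlopeAlong h (fun u => u) s := ⟨s, hs⟩
  rw [germSlope, dif_pos hex]
  exact hex.choose_spec.unique hs

theorem rightSlope_eq {h : ℝ → ℝ} {t : ℝ} {s : ℤ} (hs : HasSlopeAlong h (fun u => t + u) s) :
    rightSlope h t = s := germSlope_eq hs

theorem leftSlope_eq {h : ℝ → ℝ} {t : ℝ} {s : ℤ} (hs : HasSlopeAlong h (fun u => t - u) s) :
    leftSlope h t = s := germSlope_eq hs

theorem PiecewiseAffine.right {h : ℝ → ℝ} (hh : PiecewiseAffine h) (t : ℝ) :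
    HasSlopeAlong h (fun u => t + u) (rightSlope h t) := by
  obtain ⟨s, hs⟩ := (hh t).1
  rwa [rightSlope_eq hs]

theorem PiecewiseAffine.left {h : ℝ → ℝ} (hh : PiecewiseAffine h) (t : ℝ) :
    HasSlopeAlong h (fun u => t - u) (leftSlope h t) := by
  obtain ⟨s, hs⟩ := (hh t).2
  rwa [leftSlope_eq hs]

theorem PiecewiseAffine.exists_slopes_nhds {h : ℝ → ℝ} (hh : PiecewiseAffine h) (t : ℝ) :
    ∃ ε > 0, ∀ u ∈ Ioo (0 : ℝ) ε,
      rightSlope h (t + u) = rightSlope h t ∧ leftSlope h (t + u) = -rightSlope h t ∧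
      rightSlope h (t - u) = -leftSlope h t ∧ leftSlope h (t - u) = leftSlope h t := by
  obtain ⟨ε, hε, hr⟩ := hh.right t
  obtain ⟨ε', hε', hl⟩ := hh.left t
  refine ⟨min ε ε', lt_min hε hε', fun u hu => ?_⟩
  have hu1 : u < ε := hu.2.trans_le (min_le_left _ _)
  have hu2 : u < ε' := hu.2.trans_le (min_le_right _ _)
  have hu0 := hu.1
  refine ⟨rightSlope_eq ⟨ε - u, by linarith, fun v hv => ?_⟩,
    leftSlope_eq ⟨u, hu0, fun v hv => ?_⟩, rightSlope_eq ⟨u, hu0, fun v hv => ?_⟩,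
    leftSlope_eq ⟨ε' - u, by linarith, fun v hv => ?_⟩⟩
  · have h1 := hr (u + v) ⟨by linarith [hv.1], by linarith [hv.2]⟩
    have h2 := hr u ⟨hu0.le, hu1.le⟩
    simp only [add_zero, ← add_assoc] at h1 h2 ⊢
    linarith
  · have h1 := hr (u - v) ⟨by linarith [hv.2], by linarith [hv.1]⟩
    have h2 := hr u ⟨hu0.le, hu1.le⟩
    simp only [add_zero, sub_zero, ← add_sub_assoc] at h1 h2 ⊢
    push_cast
    linarith
  · have h1 := hl (u - v) ⟨by linarith [hv.2], by linarith [hv.1]⟩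
    have h2 := hl u ⟨hu0.le, hu2.le⟩
    simp only [add_zero, sub_zero, ← sub_add] at h1 h2 ⊢
    push_cast
    linarith
  · have h1 := hl (u + v) ⟨by linarith [hv.1], by linarith [hv.2]⟩
    have h2 := hl u ⟨hu0.le, hu2.le⟩
    simp only [sub_zero, ← sub_sub] at h1 h2 ⊢
    linarith

theorem PiecewiseAffine.eventually_kink_eq_zero {h : ℝ → ℝ} (hh : PiecewiseAffine h) (t : ℝ) :
    ∀ᶠ x in 𝓝[≠] t, kink h x = 0 := by
  obtain ⟨ε, hε, H⟩ := hh.exists_slopes_nhds t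
  filter_upwards [self_mem_nhdsWithin, mem_nhdsWithin_of_mem_nhds (Metric.ball_mem_nhds t hε)]
    with x hx hxε
  rw [Metric.mem_ball, Real.dist_eq, abs_lt] at hxε
  rcases lt_or_gt_of_ne hx with hlt | hgt
  · obtain ⟨-, -, h1, h2⟩ := H (t - x) ⟨by linarith, by linarith⟩
    rw [sub_sub_cancel] at h1 h2
    rw [kink, h1, h2, neg_add_cancel]
  · obtain ⟨h1, h2, -, -⟩ := H (x - t) ⟨by linarith, by linarith⟩
    rw [add_sub_cancel] at h1 h2
    rw [kink, h1, h2, add_neg_cancel]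

theorem PiecewiseAffine.finite_kinks {h : ℝ → ℝ} (hh : PiecewiseAffine h) (a b : ℝ) :
    {t | t ∈ Ioc a b ∧ kink h t ≠ 0}.Finite := by
  by_contra hinf
  obtain ⟨t, -, ht⟩ := Set.Infinite.exists_accPt_of_subset_isCompact (K := Icc a b) hinf
    isCompact_Icc fun x hx => Ioc_subset_Icc_self hx.1
  rw [accPt_iff_frequently_nhdsNE] at ht
  exact ht ((hh.eventually_kink_eq_zero t).mono fun x hx hx' => hx'.2 hx)

/-- The right slope changes by the sum of the kinks passed. -/
theorem PiecewiseAffine.rightSlope_eq_add_sum {h : ℝ → ℝ} (hh : PiecewiseAffine h) {a b : ℝ}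
    {K : Finset ℝ} (hK : ∀ t ∈ Ioc a b, t ∉ K → kink h t = 0) (hKa : ∀ t ∈ K, a < t) {t : ℝ}
    (ht : t ∈ Icc a b) :
    rightSlope h t = rightSlope h a + ∑ s ∈ K with s ≤ t, kink h s := by
  have hcont : ContinuousOn (fun t => rightSlope h t - ∑ s ∈ K with s ≤ t, kink h s) (Icc a b) := by
    intro x hx
    obtain ⟨ε, hε, H⟩ := hh.exists_slopes_nhds x
    have hKx : ∀ᶠ y in 𝓝 x, y ∉ K.erase x :=
      (K.erase x).finite_toSet.isClosed.isOpen_compl.mem_nhds (by simp)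
    obtain ⟨δ, hδ, hδK⟩ := Metric.eventually_nhds_iff_ball.1 hKx
    refine ContinuousWithinAt.congr_of_eventuallyEq (continuousWithinAt_const
      (b := rightSlope h x - ∑ s ∈ K with s ≤ x, kink h s)) ?_ rfl
    filter_upwards [self_mem_nhdsWithin,
      mem_nhdsWithin_of_mem_nhds (Metric.ball_mem_nhds x (lt_min hε hδ))] with y hy hyε
    rw [Metric.mem_ball, Real.dist_eq, abs_lt] at hyε
    have hm1 := min_le_left ε δ
    have hm2 := min_le_right ε δ
    have hnear : ∀ s ∈ K, |s - x| < δ → s = x := by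
      intro s hs hsx
      by_contra hne
      exact hδK s (by rwa [Metric.mem_ball, Real.dist_eq]) (Finset.mem_erase.2 ⟨hne, hs⟩)
    rcases lt_trichotomy y x with hlt | rfl | hgt
    · obtain ⟨-, -, h1, -⟩ := H (x - y) ⟨by linarith, by linarith⟩
      rw [sub_sub_cancel] at h1
      have hxab : x ∈ Ioc a b := ⟨hy.1.trans_lt hlt, hx.2⟩
      have hsum : ∑ s ∈ K with s ≤ x, kink h s = (∑ s ∈ K with s ≤ y, kink h s) + kink h x := by
        by_cases hxK : x ∈ K
        · have : ({s ∈ K | s ≤ x} : Finset ℝ) = insert x {s ∈ K | s ≤ y} := by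
            ext s
            simp only [Finset.mem_filter, Finset.mem_insert]
            constructor
            · rintro ⟨hs, hsx⟩
              by_cases hsy : s ≤ y
              · exact Or.inr ⟨hs, hsy⟩
              · exact Or.inl (hnear s hs (abs_lt.2 ⟨by linarith, by linarith⟩))
            · rintro (rfl | ⟨hs, hsy⟩)
              · exact ⟨hxK, le_rfl⟩
              · exact ⟨hs, hsy.trans hlt.le⟩
          rw [this, Finset.sum_insert (by simp [hlt]), add_comm]
        · rw [hK x hxab hxK, add_zero]
          congr 1
          ext s
          simp only [Finset.mem_filter, and_congr_right_iff]
          refine fun hs => ⟨fun hsx => ?_, fun hsy => hsy.trans hlt.le⟩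
          by_contra hsy
          exact hxK (hnear s hs (abs_lt.2 ⟨by linarith, by linarith⟩) ▸ hs)
      rw [hsum, h1, kink]
      ring
    · rfl
    · obtain ⟨h1, -, -, -⟩ := H (y - x) ⟨by linarith, by linarith⟩
      rw [add_sub_cancel] at h1
      rw [h1]
      congr 2
      ext s
      simp only [Finset.mem_filter, and_congr_right_iff]
      refine fun hs => ⟨fun hsy => ?_, fun hsx => hsx.trans hgt.le⟩
      by_contra hsx
      exact hsx (hnear s hs (abs_lt.2 ⟨by linarith, by linarith⟩)).le
  have hconst := isPreconnected_Icc.constant hcont ht (left_mem_Icc.2 (ht.1.trans ht.2))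
  have hempty : ({s ∈ K | s ≤ a} : Finset ℝ) = ∅ :=
    Finset.filter_eq_empty_iff.2 fun s hs => not_le.2 (hKa s hs)
  simp only [hempty, Finset.sum_empty] at hconst
  linarith

/-- A function whose right slope is constantly `p` on `[a, b)` is affine there. -/
theorem PiecewiseAffine.eq_add_mul {h : ℝ → ℝ} (hh : PiecewiseAffine h) (hc : Continuous h)
    {a b : ℝ} (hab : a ≤ b) {p : ℤ} (hp : ∀ t ∈ Ico a b, rightSlope h t = p) :
    h b = h a + p * (b - a) := by
  have := constant_of_has_deriv_right_zero (f := fun t => h t - p * t) (a := a) (b := b)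
    (by fun_prop) (fun x hx => ?_) b (right_mem_Icc.2 hab)
  · linarith
  · have hd : HasDerivWithinAt (fun _ : ℝ => h x - p * x) 0 (Ici x) x :=
      hasDerivWithinAt_const _ _ _
    refine hd.congr_of_eventuallyEq ?_ rfl
    obtain ⟨ε, hε, H⟩ := hh.right x
    filter_upwards [self_mem_nhdsWithin, mem_nhdsWithin_of_mem_nhds (Metric.ball_mem_nhds x hε)]
      with y hy hyε
    rw [Metric.mem_ball, Real.dist_eq, abs_lt] at hyε
    have h1 := H (y - x) ⟨sub_nonneg.2 hy, by linarith⟩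
    rw [hp x hx] at h1
    simp only [add_sub_cancel, add_zero] at h1
    linarith

end Slopes

section Circles

open Set Filter Topology

namespace CircleParam

variable {Γ : Type*} [MetricSpace Γ] {S : Set Γ} {L : ℝ} {φ : ℝ → Γ}

theorem periodic (hφ : CircleParam S L φ) : Function.Periodic φ L := hφ.2.1

theorem mem (hφ : CircleParam S L φ) (t : ℝ) : φ t ∈ S := hφ.2.2.1 ▸ mem_range_self t

theorem exists_eq (hφ : CircleParam S L φ) {x : Γ} (hx : x ∈ S) : ∃ t, φ t = x := by
  rwa [← hφ.2.2.1] at hx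

theorem exists_mem_Ioc (hφ : CircleParam S L φ) {x : Γ} (hx : x ∈ S) (a : ℝ) :
    ∃ t ∈ Ioc a (a + L), φ t = x := by
  obtain ⟨s, rfl⟩ := hφ.exists_eq hx
  obtain ⟨t, ht, hst⟩ := hφ.periodic.exists_mem_Ioc hφ.1 s a
  exact ⟨t, ht, hst.symm⟩

theorem dist_eq (hφ : CircleParam S L φ) {s t : ℝ} (h : |s - t| ≤ L / 2) :
    dist (φ s) (φ t) = |s - t| := hφ.2.2.2 s t h

theorem eq_of_abs_sub_lt (hφ : CircleParam S L φ) {s t : ℝ} (h : φ s = φ t) (hst : |s - t| < L) :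
    s = t := by
  have key : ∀ {s t : ℝ}, φ s = φ t → |s - t| ≤ L / 2 → s = t := by
    intro s t h hst
    have := hφ.dist_eq hst
    rw [h, dist_self] at this
    exact sub_eq_zero.1 (abs_eq_zero.1 this.symm)
  rw [abs_lt] at hst
  rcases le_or_gt (|s - t|) (L / 2) with h1 | h1
  · exact key h h1
  exfalso
  rcases lt_abs.1 h1 with h2 | h2
  · have := key ((hφ.periodic.sub_eq s).trans h) (abs_le.2 ⟨by linarith, by linarith⟩)
    linarith
  · have := key ((hφ.periodic s).trans h) (abs_le.2 ⟨by linarith, by linarith⟩)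
    linarith

theorem injOn (hφ : CircleParam S L φ) (a : ℝ) : InjOn φ (Ioc a (a + L)) :=
  fun _ hs _ ht h => hφ.eq_of_abs_sub_lt h
    (abs_lt.2 ⟨by linarith [hs.1, ht.2], by linarith [hs.2, ht.1]⟩)

theorem continuous (hφ : CircleParam S L φ) : Continuous φ := by
  have hL := hφ.1
  refine Metric.continuous_iff.2 fun t ε hε => ⟨min ε (L / 2), lt_min hε (by linarith), ?_⟩
  intro s hs
  rw [Real.dist_eq] at hs
  rw [hφ.dist_eq (hs.le.trans (min_le_right _ _))]
  exact hs.trans_le (min_le_left _ _)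

theorem isArcAt_right (hφ : CircleParam S L φ) (t : ℝ) : IsArcAt (φ t) fun u => φ (t + u) := by
  have hL := hφ.1
  refine ⟨by simp, L / 2, by linarith, fun s hs u hu => ?_⟩
  rw [hφ.dist_eq] <;> rw [add_sub_add_left_eq_sub]
  exact abs_le.2 ⟨by linarith [hs.1, hu.2], by linarith [hs.2, hu.1]⟩

theorem isArcAt_left (hφ : CircleParam S L φ) (t : ℝ) : IsArcAt (φ t) fun u => φ (t - u) := by
  have hL := hφ.1
  refine ⟨by simp, L / 2, by linarith, fun s hs u hu => ?_⟩
  rw [hφ.dist_eq] <;> rw [sub_sub_sub_cancel_left, abs_sub_comm]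
  exact abs_le.2 ⟨by linarith [hs.1, hu.2], by linarith [hs.2, hu.1]⟩

theorem piecewiseAffine_comp (hφ : CircleParam S L φ) {f : Γ → ℝ} (hf : IsRational Γ f) :
    PiecewiseAffine (f ∘ φ) := fun t =>
  ⟨hf.2 _ _ (hφ.isArcAt_right t), hf.2 _ _ (hφ.isArcAt_left t)⟩

end CircleParam

theorem Function.Periodic.kink {h : ℝ → ℝ} {L : ℝ} (hh : Function.Periodic h L) :
    Function.Periodic (kink h) L := by
  intro t
  unfold _root_.kink rightSlope leftSlope
  congr 2 <;> funext u
  · rw [add_right_comm, hh]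
  · rw [add_sub_right_comm, hh]

theorem Function.Periodic.rightSlope {h : ℝ → ℝ} {L : ℝ} (hh : Function.Periodic h L) :
    Function.Periodic (rightSlope h) L := by
  intro t
  unfold _root_.rightSlope
  congr 1
  funext u
  rw [add_right_comm, hh]

open Classical in
/-- The divisor on the circle parametrized by `φ` of the restriction of `f`, as a function. -/
noncomputable def circleOrder {Γ : Type*} (f : Γ → ℝ) (φ : ℝ → Γ) (x : Γ) : ℤ :=
  if h : ∃ t, φ t = x then kink (f ∘ φ) h.choose else 0

namespace CircleParam

variable {Γ : Type*} [MetricSpace Γ] {S : Set Γ} {L : ℝ} {φ : ℝ → Γ} {f : Γ → ℝ}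

theorem circleOrder_apply (hφ : CircleParam S L φ) (f : Γ → ℝ) (t : ℝ) :
    circleOrder f φ (φ t) = kink (f ∘ φ) t := by
  have hex : ∃ s, φ s = φ t := ⟨t, rfl⟩
  have hk : Function.Periodic (kink (f ∘ φ)) L := (hφ.periodic.comp f).kink
  rw [circleOrder, dif_pos hex]
  have hpair : Function.Periodic (fun t => (φ t, kink (f ∘ φ) t)) L :=
    fun t => Prod.ext (hφ.periodic t) (hk t)
  obtain ⟨u, hu, hu'⟩ := hpair.exists_mem_Ioc hφ.1 t 0
  obtain ⟨u₂, hu₂, hu₂'⟩ := hpair.exists_mem_Ioc hφ.1 hex.choose 0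
  rw [Prod.mk.injEq] at hu' hu₂'
  have : u = u₂ := hφ.injOn 0 hu hu₂ (by rw [← hu'.1, ← hu₂'.1, hex.choose_spec])
  rw [hu'.2, hu₂'.2, this]

theorem circleOrder_of_notMem (hφ : CircleParam S L φ) (f : Γ → ℝ) {x : Γ} (hx : x ∉ S) :
    circleOrder f φ x = 0 := by
  rw [circleOrder, dif_neg]
  rintro ⟨t, rfl⟩
  exact hx (hφ.mem t)

theorem finite_support_circleOrder (hφ : CircleParam S L φ) (hf : IsRational Γ f) :
    (Function.support (circleOrder f φ)).Finite := by
  refine (((hφ.piecewiseAffine_comp hf).finite_kinks 0 (0 + L)).image φ).subset fun x hx => ?_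
  have hxS : x ∈ S := by
    by_contra hxS
    exact hx (hφ.circleOrder_of_notMem f hxS)
  obtain ⟨t, ht, rfl⟩ := hφ.exists_mem_Ioc hxS 0
  exact ⟨t, ⟨ht, by rwa [Function.mem_support, hφ.circleOrder_apply] at hx⟩, rfl⟩

/-- The divisor of the restriction of the rational function `f` to a circle. -/
noncomputable def circleDiv (hφ : CircleParam S L φ) (hf : IsRational Γ f) : Divisor Γ :=
  Finsupp.ofSupportFinite (circleOrder f φ) (hφ.finite_support_circleOrder hf)

theorem circleDiv_apply (hφ : CircleParam S L φ) (hf : IsRational Γ f) (x : Γ) :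
    hφ.circleDiv hf x = circleOrder f φ x := rfl

/-- The parameters in `(a, a + L]` at which `f ∘ φ` changes slope. -/
noncomputable def kinks (hφ : CircleParam S L φ) (hf : IsRational Γ f) (a : ℝ) : Finset ℝ :=
  ((hφ.piecewiseAffine_comp hf).finite_kinks a (a + L)).toFinset

theorem mem_kinks (hφ : CircleParam S L φ) (hf : IsRational Γ f) {a t : ℝ} :
    t ∈ hφ.kinks hf a ↔ t ∈ Ioc a (a + L) ∧ kink (f ∘ φ) t ≠ 0 := by
  simp [kinks]

theorem rightSlope_eq_add_sum_kinks (hφ : CircleParam S L φ) (hf : IsRational Γ f) {a t : ℝ}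
    (ht : t ∈ Icc a (a + L)) :
    rightSlope (f ∘ φ) t = rightSlope (f ∘ φ) a +
      ∑ s ∈ hφ.kinks hf a with s ≤ t, kink (f ∘ φ) s := by
  refine (hφ.piecewiseAffine_comp hf).rightSlope_eq_add_sum (b := a + L) ?_ ?_ ht
  · intro s hs hsK
    by_contra hne
    exact hsK ((hφ.mem_kinks hf).2 ⟨hs, hne⟩)
  · intro s hs
    exact ((hφ.mem_kinks hf).1 hs).1.1

/-- A principal divisor on a circle has degree zero. -/
theorem divDeg_circleDiv (hφ : CircleParam S L φ) (hf : IsRational Γ f) :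
    divDeg (hφ.circleDiv hf) = 0 := by
  classical
  have h1 := hφ.rightSlope_eq_add_sum_kinks hf (a := 0) (t := 0 + L) ⟨by linarith [hφ.1], le_rfl⟩
  rw [(hφ.periodic.comp f).rightSlope 0, left_eq_add, Finset.filter_true_of_mem
    fun s hs => ((hφ.mem_kinks hf).1 hs).1.2] at h1
  have himg : (hφ.circleDiv hf).support = (hφ.kinks hf 0).image φ := by
    ext x
    rw [Finsupp.mem_support_iff, circleDiv_apply, Finset.mem_image]
    constructor
    · intro hx
      have hxS : x ∈ S := by
        by_contra hxS
        exact hx (hφ.circleOrder_of_notMem f hxS)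
      obtain ⟨t, ht, rfl⟩ := hφ.exists_mem_Ioc hxS 0
      exact ⟨t, (hφ.mem_kinks hf).2 ⟨ht, by rwa [hφ.circleOrder_apply] at hx⟩, rfl⟩
    · rintro ⟨t, ht, rfl⟩
      rw [hφ.circleOrder_apply]
      exact ((hφ.mem_kinks hf).1 ht).2
  rw [divDeg, Finsupp.sum, himg, Finset.sum_image]
  · rw [← h1]
    exact Finset.sum_congr rfl fun t _ => hφ.circleOrder_apply f t
  · exact (hφ.injOn 0).mono fun s hs => ((hφ.mem_kinks hf).1 hs).1

theorem circleOrder_nonpos (hφ : CircleParam S L φ) (hf : IsRational Γ f) {v : Γ}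
    (hnonneg : ∀ x ∈ S, x ≠ v → 0 ≤ circleOrder f φ x) : circleOrder f φ v ≤ 0 := by
  classical
  by_cases hv : circleOrder f φ v = 0
  · exact hv.le
  have hdeg := hφ.divDeg_circleDiv hf
  rw [divDeg, Finsupp.sum,
    ← Finset.add_sum_erase _ _ (Finsupp.mem_support_iff.2 hv : v ∈ (hφ.circleDiv hf).support),
    circleDiv_apply] at hdeg
  have : 0 ≤ ∑ x ∈ (hφ.circleDiv hf).support.erase v, hφ.circleDiv hf x := by
    refine Finset.sum_nonneg fun x hx => ?_
    rw [circleDiv_apply]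
    by_cases hxS : x ∈ S
    · exact hnonneg x hxS (Finset.ne_of_mem_erase hx)
    · exact (hφ.circleOrder_of_notMem f hxS).ge
  omega

/-- On a circle, distinct points are not linearly equivalent: a principal divisor whose only
negative coefficient is at `v` and which is not zero has coefficient at most `-2` at `v`. -/
theorem circleOrder_le_neg_two (hφ : CircleParam S L φ) (hf : IsRational Γ f) {v x₀ : Γ}
    (hv : v ∈ S) (hx₀S : x₀ ∈ S) (hx₀ : x₀ ≠ v) (hpos : 1 ≤ circleOrder f φ x₀)
    (hnonneg : ∀ x ∈ S, x ≠ v → 0 ≤ circleOrder f φ x) :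
    circleOrder f φ v ≤ -2 := by
  classical
  obtain ⟨a, rfl⟩ := hφ.exists_eq hv
  have hL := hφ.1
  have hend : φ (a + L) = φ a := hφ.periodic a
  have hne : ∀ t ∈ Ioo a (a + L), φ t ≠ φ a := by
    intro t ht h
    have := hφ.eq_of_abs_sub_lt h (abs_lt.2 ⟨by linarith [ht.1], by linarith [ht.2]⟩)
    exact ht.1.ne this.symm
  obtain ⟨l, hl, rfl⟩ := hφ.exists_mem_Ioc hx₀S a
  have hl' : l ∈ Ioo a (a + L) := ⟨hl.1, lt_of_le_of_ne hl.2 fun h => hx₀ (h ▸ hend)⟩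
  set h := f ∘ φ with hh
  rw [hφ.circleOrder_apply, ← hh] at hpos ⊢
  have hk0 : ∀ t ∈ Ioo a (a + L), 0 ≤ kink h t := fun t ht => by
    rw [← hφ.circleOrder_apply]
    exact hnonneg _ (hφ.mem t) (hne t ht)
  set K := hφ.kinks hf a with hK
  have hKmem : ∀ {t}, t ∈ K ↔ t ∈ Ioc a (a + L) ∧ kink h t ≠ 0 := hφ.mem_kinks hf
  have htot : ∑ s ∈ K, kink h s = 0 := by
    have h1 := hφ.rightSlope_eq_add_sum_kinks hf (a := a) (t := a + L) ⟨by linarith, le_rfl⟩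
    rwa [(hφ.periodic.comp f).rightSlope a, left_eq_add, Finset.filter_true_of_mem
      fun s hs => (hKmem.1 hs).1.2] at h1
  have hlast : kink h (a + L) = kink h a := (hφ.periodic.comp f).kink a
  have hsplit : (∑ s ∈ K.erase (a + L), kink h s) + kink h a = 0 := by
    by_cases hmem : a + L ∈ K
    · rw [← hlast, Finset.sum_erase_add _ _ hmem, htot]
    · rw [Finset.erase_eq_of_notMem hmem, htot, zero_add, ← hlast]
      by_contra hne
      exact hmem (hKmem.2 ⟨⟨by linarith, le_rfl⟩, hne⟩)
  have hKin : ∀ s ∈ K.erase (a + L), s ∈ Ioo a (a + L) := fun s hs => by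
    obtain ⟨h1, h2⟩ := Finset.mem_erase.1 hs
    obtain ⟨h3, -⟩ := hKmem.1 h2
    exact ⟨h3.1, lt_of_le_of_ne h3.2 h1⟩
  have hlK : l ∈ K.erase (a + L) :=
    Finset.mem_erase.2 ⟨hl'.2.ne, hKmem.2 ⟨hl, by omega⟩⟩
  rw [← Finset.add_sum_erase _ _ hlK] at hsplit
  have hrest : 0 ≤ ∑ s ∈ (K.erase (a + L)).erase l, kink h s :=
    Finset.sum_nonneg fun s hs => hk0 s (hKin s (Finset.mem_of_mem_erase hs))
  by_contra hcon
  have hone : kink h l = 1 := by omega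
  have hzero : ∑ s ∈ (K.erase (a + L)).erase l, kink h s = 0 := by omega
  have honly : ∀ s ∈ K.erase (a + L), s = l := by
    intro s hs
    by_contra hsl
    have := (Finset.sum_eq_zero_iff_of_nonneg fun s hs =>
      hk0 s (hKin s (Finset.mem_of_mem_erase hs))).1 hzero s (Finset.mem_erase.2 ⟨hsl, hs⟩)
    exact (hKmem.1 (Finset.mem_of_mem_erase hs)).2 this
  have hslope : ∀ t ∈ Ico a (a + L), rightSlope h t = rightSlope h a + if l ≤ t then 1 else 0 := by
    intro t ht
    rw [hφ.rightSlope_eq_add_sum_kinks hf (a := a) ⟨ht.1, ht.2.le⟩]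
    congr 1
    have hfil : ({s ∈ K | s ≤ t} : Finset ℝ) = if l ≤ t then {l} else ∅ := by
      ext s
      have hiff : s ∈ K ∧ s ≤ t ↔ s = l ∧ l ≤ t := by
        constructor
        · rintro ⟨hs, hst⟩
          have := honly s (Finset.mem_erase.2 ⟨(hst.trans_lt ht.2).ne, hs⟩)
          exact ⟨this, this ▸ hst⟩
        · rintro ⟨rfl, hst⟩
          exact ⟨Finset.mem_of_mem_erase hlK, hst⟩
      rw [Finset.mem_filter, hiff]
      split_ifs with hlt <;> simp [hlt]
    rw [hfil]
    split_ifs <;> simp [← hh, hone]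
  have hpa : PiecewiseAffine h := hφ.piecewiseAffine_comp hf
  have hc : Continuous h := hf.1.comp hφ.continuous
  have e1 := hpa.eq_add_mul hc hl.1.le (p := rightSlope h a) fun t ht => by
    rw [hslope t ⟨ht.1, ht.2.trans hl'.2⟩, if_neg (not_le.2 ht.2), add_zero]
  have e2 := hpa.eq_add_mul hc hl.2 (p := rightSlope h a + 1) fun t ht => by
    rw [hslope t ⟨hl.1.le.trans ht.1, ht.2⟩, if_pos ht.1]
  have e3 : h (a + L) = h a := congrArg f hend
  rw [e3, e1] at e2
  push_cast at e2
  have e4 : ((rightSlope h a + 1 : ℤ) : ℝ) * L = l - a := by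
    push_cast
    linarith
  have hgt : (0 : ℝ) < ((rightSlope h a + 1 : ℤ) : ℝ) := by
    by_contra hle
    nlinarith [hl.1, mul_nonpos_of_nonpos_of_nonneg (not_lt.1 hle) hL.le]
  have hge : (1 : ℝ) ≤ ((rightSlope h a + 1 : ℤ) : ℝ) := by
    exact_mod_cast Int.add_one_le_iff.2 (Int.cast_pos.1 hgt)
  nlinarith [hl'.2, mul_le_mul_of_nonneg_right hge hL.le]

end CircleParam

end Circles

section CircleCovers

open Set Filter Topology

/-- The branch at parameter `t` of the curve `φ`, in the positive direction if `b` is true and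
in the negative direction otherwise. -/
def curveBranch {Γ : Type*} (φ : ℝ → Γ) (t : ℝ) (b : Bool) (u : ℝ) : Γ :=
  cond b (φ (t + u)) (φ (t - u))

theorem curveBranch_zero {Γ : Type*} (φ : ℝ → Γ) (t : ℝ) (b : Bool) :
    curveBranch φ t b 0 = φ t := by
  cases b <;> simp [curveBranch]

namespace CircleParam

variable {Γ : Type*} [MetricSpace Γ] {S : Set Γ} {L : ℝ} {φ : ℝ → Γ}

theorem isArcAt_curveBranch (hφ : CircleParam S L φ) (t : ℝ) (b : Bool) :
    IsArcAt (φ t) (curveBranch φ t b) := by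
  cases b
  · exact hφ.isArcAt_left t
  · exact hφ.isArcAt_right t

theorem curveBranch_mem (hφ : CircleParam S L φ) (t : ℝ) (b : Bool) (u : ℝ) :
    curveBranch φ t b u ∈ S := by
  cases b <;> exact hφ.mem _

theorem continuous_curveBranch (hφ : CircleParam S L φ) (t : ℝ) (b : Bool) :
    Continuous (curveBranch φ t b) := by
  have := hφ.continuous
  cases b
  · exact this.comp (continuous_sub_left t)
  · exact this.comp (continuous_const_add t)

theorem exists_curveBranch_eq (hφ : CircleParam S L φ) {x : Γ} (hx : x ∈ S) (t : ℝ) :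
    ∃ b, curveBranch φ t b (dist x (φ t)) = x := by
  obtain ⟨s, hs, rfl⟩ := hφ.exists_mem_Ioc hx (t - L / 2)
  rw [hφ.dist_eq (abs_le.2 ⟨by linarith [hs.1], by linarith [hs.2]⟩)]
  rcases abs_cases (s - t) with ⟨h, -⟩ | ⟨h, -⟩
  · exact ⟨true, by rw [h, curveBranch, cond_true, add_sub_cancel]⟩
  · exact ⟨false, by rw [h, curveBranch, cond_false, sub_neg_eq_add, add_sub_cancel]⟩

theorem dist_curveBranch (hφ : CircleParam S L φ) (t : ℝ) (b : Bool) {u : ℝ} (hu : 0 ≤ u)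
    (huL : u ≤ L / 2) : dist (curveBranch φ t b u) (φ t) = u := by
  cases b
  · rw [curveBranch, cond_false, hφ.dist_eq] <;> rw [sub_sub_cancel_left, abs_neg, abs_of_nonneg hu]
    exact huL
  · rw [curveBranch, cond_true, hφ.dist_eq] <;> rw [add_sub_cancel_left, abs_of_nonneg hu]
    exact huL

theorem curveBranch_ne (hφ : CircleParam S L φ) (t : ℝ) {b c : Bool} (hbc : b ≠ c) {u : ℝ}
    (hu : 0 < u) (huL : u ≤ L / 4) : curveBranch φ t b u ≠ curveBranch φ t c u := by
  have key : φ (t + u) ≠ φ (t - u) := by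
    intro h
    have hL := hφ.1
    have := hφ.eq_of_abs_sub_lt h (abs_lt.2 ⟨by linarith, by linarith⟩)
    linarith
  cases b <;> cases c
  · exact absurd rfl hbc
  · exact key.symm
  · exact key
  · exact absurd rfl hbc

end CircleParam

/-- Finitely many metric circles covering a metric space, meeting pairwise in at most
one point. -/
structure CircleCover {Γ ι : Type*} [MetricSpace Γ] (S : ι → Set Γ) (L : ι → ℝ)
    (φ : ι → ℝ → Γ) : Prop where
  param : ∀ i, CircleParam (S i) (L i) (φ i)
  isClosed : ∀ i, IsClosed (S i)
  exists_mem : ∀ x, ∃ i, x ∈ S i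
  inter : ∀ i j, i ≠ j → (S i ∩ S j).Subsingleton

namespace CircleCover

variable {Γ ι : Type*} [MetricSpace Γ] {S : ι → Set Γ} {L : ι → ℝ} {φ : ι → ℝ → Γ}

theorem curveBranch_ne (hS : CircleCover S L φ) {i j : ι} {b c : Bool} {s t : ℝ} {P : Γ}
    (hs : φ i s = P) (ht : φ j t = P) (hst : i = j → s = t) (hne : (i, b) ≠ (j, c)) {u : ℝ}
    (hu : 0 < u) (hui : u ≤ L i / 4) : curveBranch (φ i) s b u ≠ curveBranch (φ j) t c u := by
  by_cases hij : i = j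
  · obtain rfl := hij
    obtain rfl := hst rfl
    exact (hS.param i).curveBranch_ne s (fun h => hne (by rw [h])) hu hui
  · intro h
    have hx := hS.inter i j hij
      ⟨(hS.param i).curveBranch_mem s b u, h ▸ (hS.param j).curveBranch_mem t c u⟩
      ⟨hs ▸ (hS.param i).mem s, ht ▸ (hS.param j).mem t⟩
    have hd := (hS.param i).dist_curveBranch s b hu.le (by linarith [(hS.param i).1])
    rw [hx, hs, dist_self] at hd
    exact hu.ne hd

variable [Fintype ι]

/-- An arc at `P` follows a branch of one of the circles through `P`. -/
theorem exists_arcEquiv (hS : CircleCover S L φ) {P : Γ} (t : {i // P ∈ S i} → ℝ)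
    (ht : ∀ i : {i // P ∈ S i}, φ i (t i) = P) {σ : ℝ → Γ} (hσ : IsArcAt P σ) :
    ∃ p : {i // P ∈ S i} × Bool, ArcEquiv σ (curveBranch (φ p.1) (t p.1) p.2) := by
  classical
  obtain ⟨hσ0, a, ha, hσa⟩ := hσ
  have hev : ∀ᶠ x in 𝓝 P, ∀ i, P ∉ S i → x ∉ S i := by
    refine eventually_all.2 fun i => ?_
    by_cases hi : P ∈ S i
    · exact Eventually.of_forall fun x h => absurd hi h
    · filter_upwards [(hS.isClosed i).isOpen_compl.mem_nhds hi] with x hx _ using hx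
  obtain ⟨δ, hδ, hδS⟩ := Metric.eventually_nhds_iff_ball.1 hev
  have hL : ∀ᶠ ε in 𝓝[>] (0 : ℝ), ε ≤ a ∧ ε < δ ∧ ∀ i, ε ≤ L i / 4 := by
    have hlt : ∀ c : ℝ, 0 < c → ∀ᶠ ε in 𝓝[>] (0 : ℝ), ε < c := fun c hc =>
      mem_nhdsWithin_of_mem_nhds (Iio_mem_nhds hc)
    refine ((hlt a ha).mono fun _ => le_of_lt).and ((hlt δ hδ).and (eventually_all.2 fun i => ?_))
    exact (hlt _ (by have := (hS.param i).1; positivity)).mono fun _ => le_of_lt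
  obtain ⟨ε, ⟨hεa, hεδ, hεL⟩, hε⟩ := (hL.and self_mem_nhdsWithin).exists
  have hε : 0 < ε := hε
  have hσcont : ContinuousOn σ (Ioc 0 ε) := by
    intro x hx
    refine Metric.continuousWithinAt_iff.2 fun η hη => ⟨η, hη, fun {y} hy hyx => ?_⟩
    rw [hσa y ⟨hy.1.le, hy.2.trans hεa⟩ x ⟨hx.1.le, hx.2.trans hεa⟩]
    rwa [Real.dist_eq] at hyx
  have hbr : ∀ u : Ioc (0 : ℝ) ε, ∃ p : {i // P ∈ S i} × Bool,
      σ u = curveBranch (φ p.1) (t p.1) p.2 u := by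
    rintro ⟨u, hu⟩
    have hd : dist (σ u) P = u := by
      rw [← hσ0, hσa u ⟨hu.1.le, hu.2.trans hεa⟩ 0 ⟨le_rfl, ha.le⟩, sub_zero, abs_of_pos hu.1]
    obtain ⟨i, hi⟩ := hS.exists_mem (σ u)
    have hPi : P ∈ S i := by
      by_contra hPi
      exact hδS (σ u) (by rw [Metric.mem_ball, hd]; exact hu.2.trans_lt hεδ) i hPi hi
    obtain ⟨b, hb⟩ := (hS.param i).exists_curveBranch_eq hi (t ⟨i, hPi⟩)
    rw [ht ⟨i, hPi⟩, hd] at hb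
    exact ⟨(⟨i, hPi⟩, b), hb.symm⟩
  choose p hp using hbr
  have huniq : ∀ (u : Ioc (0 : ℝ) ε) q, σ u = curveBranch (φ q.1) (t q.1) q.2 u → p u = q := by
    intro u q hq
    by_contra hne
    refine hS.curveBranch_ne (ht (p u).1) (ht q.1) (fun h => by rw [Subtype.ext h]) ?_ u.2.1
      (u.2.2.trans (hεL _)) ((hp u).symm.trans hq)
    intro h
    rw [Prod.mk.injEq] at h
    exact hne (Prod.ext (Subtype.ext h.1) h.2)
  let _ : TopologicalSpace ({i // P ∈ S i} × Bool) := ⊥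
  have _ : DiscreteTopology ({i // P ∈ S i} × Bool) := ⟨rfl⟩
  have hpcont : Continuous p := by
    refine continuous_iff_isClosed.2 fun s _ => ?_
    have : p ⁻¹' s =
        ⋃ q : s, {u : Ioc (0 : ℝ) ε | σ u = curveBranch (φ q.1.1) (t q.1.1) q.1.2 u} := by
      ext u
      simp only [mem_preimage, mem_iUnion, mem_ofPred_eq]
      constructor
      · exact fun hu => ⟨⟨p u, hu⟩, hp u⟩
      · rintro ⟨q, hq⟩
        rw [huniq u q hq]
        exact q.2
    rw [this]
    refine isClosed_iUnion_of_finite fun q => isClosed_eq hσcont.domRestrict ?_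
    exact ((hS.param _).continuous_curveBranch _ _).comp continuous_subtype_val
  have : PreconnectedSpace (Ioc (0 : ℝ) ε) := Subtype.preconnectedSpace isPreconnected_Ioc
  refine ⟨p ⟨ε, hε, le_rfl⟩, ε, hε, fun u hu => ?_⟩
  rcases hu.1.eq_or_lt with rfl | hu0
  · exact hσ0.trans ((curveBranch_zero _ _ _).trans (ht _)).symm
  · rw [PreconnectedSpace.constant ‹_› hpcont (x := ⟨ε, hε, le_rfl⟩) (y := ⟨u, hu0, hu.2⟩)]
    exact hp ⟨u, hu0, hu.2⟩

/-- The divisor of a rational function is the sum of the divisors of its restrictions to the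
circles of a circle cover. -/
theorem hasOrderAt (hS : CircleCover S L φ) {f : Γ → ℝ} (hf : IsRational Γ f) (P : Γ) :
    HasOrderAt Γ f P (∑ i, circleOrder f (φ i) P) := by
  classical
  choose t ht using fun i : {i // P ∈ S i} => (hS.param i).exists_eq i.2
  let e := (Fintype.equivFin ({i // P ∈ S i} × Bool)).symm
  let s : {i // P ∈ S i} × Bool → ℤ := fun p =>
    cond p.2 (rightSlope (f ∘ φ p.1) (t p.1)) (leftSlope (f ∘ φ p.1) (t p.1))
  refine ⟨_, fun k => curveBranch (φ (e k).1) (t (e k).1) (e k).2, fun k => s (e k),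
    ?_, ?_, ?_, ?_, ?_⟩
  · intro k
    have := (hS.param (e k).1).isArcAt_curveBranch (t (e k).1) (e k).2
    rwa [ht] at this
  · rintro k l hkl ⟨ε, hε, h⟩
    have hL := (hS.param (e k).1).1
    have hm : 0 < min ε (L (e k).1 / 4) := lt_min hε (by positivity)
    refine hS.curveBranch_ne (ht (e k).1) (ht (e l).1) (fun h => by rw [Subtype.ext h]) ?_ hm
      (min_le_right _ _) (h _ ⟨hm.le, min_le_left _ _⟩)
    intro h
    rw [Prod.mk.injEq] at h
    exact hkl (e.injective (Prod.ext (Subtype.ext h.1) h.2))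
  · intro σ hσ
    obtain ⟨p, hp⟩ := hS.exists_arcEquiv t ht hσ
    exact ⟨e.symm p, by simpa using hp⟩
  · have hs : ∀ p, HasSlopeAlong f (curveBranch (φ p.1) (t p.1) p.2) (s p) := by
      rintro ⟨i, b⟩
      have hpa := (hS.param i).piecewiseAffine_comp hf
      cases b
      · exact hpa.left (t i)
      · exact hpa.right (t i)
    exact fun k => hs (e k)
  · rw [Equiv.sum_comp e s, Fintype.sum_prod_type]
    have h1 : ∀ i : {i // P ∈ S i}, ∑ b : Bool, s (i, b) = circleOrder f (φ i) P := by
      intro i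
      have := (hS.param i).circleOrder_apply f (t i)
      rw [ht] at this
      rw [this, Fintype.sum_bool]
      rfl
    rw [Finset.sum_congr rfl fun i _ => h1 i, ← Fintype.sum_subtype_add_sum_subtype (P ∈ S ·)
      fun i => circleOrder f (φ i) P, add_eq_left]
    exact Finset.sum_eq_zero fun i _ => (hS.param i).circleOrder_of_notMem f i.2

end CircleCover

end CircleCovers

section Divisors

theorem divDeg_eq_degree {Γ : Type*} (D : Divisor Γ) : divDeg D = D.degree := rfl

theorem rankGE_of_divRank_eq {Γ : Type*} [MetricSpace Γ] {D : Divisor Γ} {r : ℕ} (hr : 1 ≤ r)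
    (h : divRank Γ D = r) : RankGE Γ D r := by
  have hb : BddAbove (insert (-1) {n : ℤ | ∃ r : ℕ, n = (r : ℤ) ∧ RankGE Γ D r}) := by
    by_contra hb
    rw [divRank, Int.csSup_of_not_bddAbove hb] at h
    omega
  have hmem := Int.csSup_mem (Set.insert_nonempty _ _) hb
  rw [divRank] at h
  rw [h] at hmem
  rcases hmem with h1 | ⟨s, hs, hrk⟩
  · omega
  · rwa [Nat.cast_injective hs]

/-- The restriction of a rational function to a subset is rational. -/
theorem IsRational.comp_val {Γ : Type*} [MetricSpace Γ] {f : Γ → ℝ} (hf : IsRational Γ f)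
    (T : Set Γ) : IsRational T (f ∘ Subtype.val) := by
  refine ⟨hf.1.comp continuous_subtype_val, fun P τ hτ => ?_⟩
  obtain ⟨h0, c, hc, hd⟩ := hτ
  exact hf.2 P (Subtype.val ∘ τ) ⟨congrArg Subtype.val h0, c, hc, hd⟩

theorem CircleParam.codRestrict {Γ : Type*} [MetricSpace Γ] {S T : Set Γ} {L : ℝ} {φ : ℝ → Γ}
    (hφ : CircleParam S L φ) (hST : S ⊆ T) :
    CircleParam (Subtype.val ⁻¹' S : Set T) L fun t => ⟨φ t, hST (hφ.mem t)⟩ := by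
  refine ⟨hφ.1, fun t => Subtype.ext (hφ.periodic t), ?_, fun s t h => hφ.dist_eq h⟩
  ext ⟨x, hx⟩
  constructor
  · rintro ⟨t, ht⟩
    have := congrArg Subtype.val ht
    simp only at this
    exact this ▸ hφ.mem t
  · intro h
    obtain ⟨t, ht⟩ := hφ.exists_eq h
    exact ⟨t, Subtype.ext ht⟩

theorem CircleParam.circleOrder_codRestrict {Γ : Type*} [MetricSpace Γ] {S T : Set Γ} {L : ℝ}
    {φ : ℝ → Γ} (hφ : CircleParam S L φ) (hST : S ⊆ T) (f : Γ → ℝ) (x : T) :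
    circleOrder (f ∘ Subtype.val) (fun t => ⟨φ t, hST (hφ.mem t)⟩ : ℝ → T) x =
      circleOrder f φ x := by
  by_cases hx : (x : Γ) ∈ S
  · obtain ⟨t, ht⟩ := hφ.exists_eq hx
    obtain rfl : ⟨φ t, hST (hφ.mem t)⟩ = x := Subtype.ext ht
    rw [hφ.circleOrder_apply]
    exact (hφ.codRestrict hST).circleOrder_apply _ t
  · rw [hφ.circleOrder_of_notMem f hx, (hφ.codRestrict hST).circleOrder_of_notMem _ hx]

end Divisors

namespace ChainPlusLoops

variable {a g : ℕ} (C : ChainPlusLoops a g)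

theorem loop_subset {i : ℕ} (hi : i ∈ Finset.Icc 1 a) : C.loop i ⊆ C.Γ₀ := by
  rw [C.hΓ₀]
  exact Set.subset_biUnion_of_mem (u := fun i => C.loop i) hi

theorem exists_mem_loop₀ {x : C.Γ} (hx : x ∈ C.Γ₀) : ∃ i ∈ Finset.Icc 1 a, x ∈ C.loop i := by
  rw [C.hΓ₀] at hx
  simpa using hx

theorem exists_mem_loop (x : C.Γ) : ∃ i ∈ Finset.Icc 1 g, x ∈ C.loop i := by
  have hg := C.hg
  have hx : x ∈ C.Γ₀ ∪ ⋃ i ∈ Finset.Icc (a + 1) g, C.loop i := C.cover ▸ Set.mem_univ x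
  rcases hx with hx | hx
  · obtain ⟨i, hi, hxi⟩ := C.exists_mem_loop₀ hx
    exact ⟨i, Finset.Icc_subset_Icc_right (by omega) hi, hxi⟩
  · obtain ⟨i, hi, hxi⟩ := Set.mem_iUnion₂.1 hx
    exact ⟨i, Finset.Icc_subset_Icc_left (by omega) hi, hxi⟩

theorem inter_subsingleton {i j : ℕ} (hi : i ∈ Finset.Icc 1 g) (hj : j ∈ Finset.Icc 1 g)
    (hij : i ≠ j) : (C.loop i ∩ C.loop j).Subsingleton := by
  wlog hlt : i < j generalizing i j
  · rw [Set.inter_comm]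
    exact this hj hi hij.symm (by omega)
  rw [Finset.mem_Icc] at hi hj
  rcases le_or_gt j a with hja | hja
  · rcases (Nat.succ_le_of_lt hlt).eq_or_lt with rfl | hlt'
    · rw [Nat.succ_eq_add_one, C.chainMeet i (Finset.mem_Icc.2 ⟨hi.1, by omega⟩)]
      exact Set.subsingleton_singleton
    · rw [C.chainDisj i (Finset.mem_Icc.2 ⟨hi.1, by omega⟩) j (Finset.mem_Icc.2 ⟨hj.1, hja⟩)
        (by omega)]
      exact Set.subsingleton_empty
  · have hj' : j ∈ Finset.Icc (a + 1) g := Finset.mem_Icc.2 ⟨hja, hj.2⟩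
    rcases le_or_gt i a with hia | hia
    · have hsub : C.loop i ∩ C.loop j ⊆ {C.v j} := by
        rw [← C.attachMeet j hj', Set.inter_comm (C.loop j)]
        exact Set.inter_subset_inter_left _ (C.loop_subset (Finset.mem_Icc.2 ⟨hi.1, hia⟩))
      exact Set.subsingleton_singleton.anti hsub
    · rw [C.attachDisj i (Finset.mem_Icc.2 ⟨hia, hi.2⟩) j hj' hij]
      exact Set.subsingleton_empty

variable {C}

theorem mem_loop_v {j : ℕ} (hj : j ∈ Finset.Icc (a + 1) g) : C.v j ∈ C.loop j :=
  ((C.attachMeet j hj).symm ▸ Set.mem_singleton (C.v j) : C.v j ∈ C.loop j ∩ C.Γ₀).1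

theorem eq_v_of_mem {j : ℕ} (hj : j ∈ Finset.Icc (a + 1) g) {x : C.Γ} (hx : x ∈ C.loop j)
    (hx₀ : x ∈ C.Γ₀) : x = C.v j :=
  (C.attachMeet j hj ▸ ⟨hx, hx₀⟩ : x ∈ ({C.v j} : Set C.Γ))

variable {L : ℕ → ℝ} {φ : ℕ → ℝ → C.Γ}

theorem circleCover (hφ : ∀ i ∈ Finset.Icc 1 g, CircleParam (C.loop i) (L i) (φ i)) :
    CircleCover (fun i : Finset.Icc 1 g => C.loop i) (fun i => L i) (fun i => φ i) where
  param i := hφ i i.2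
  isClosed i := C.closedLoop i i.2
  exists_mem x := by
    obtain ⟨i, hi, hx⟩ := C.exists_mem_loop x
    exact ⟨⟨i, hi⟩, hx⟩
  inter i j hij := C.inter_subsingleton i.2 j.2 fun h => hij (Subtype.ext h)

theorem hasOrderAt (hφ : ∀ i ∈ Finset.Icc 1 g, CircleParam (C.loop i) (L i) (φ i))
    {f : C.Γ → ℝ} (hf : IsRational C.Γ f) (x : C.Γ) :
    HasOrderAt C.Γ f x (∑ i ∈ Finset.Icc 1 g, circleOrder f (φ i) x) := by
  rw [← Finset.sum_coe_sort]
  exact (circleCover hφ).hasOrderAt hf x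

theorem Icc_chain_subset (C : ChainPlusLoops a g) : Finset.Icc 1 a ⊆ Finset.Icc 1 g :=
  Finset.Icc_subset_Icc_right (by have := C.hg; omega)

theorem hasOrderAt₀ (hφ : ∀ i ∈ Finset.Icc 1 g, CircleParam (C.loop i) (L i) (φ i))
    {f : C.Γ → ℝ} (hf : IsRational C.Γ f) (x : C.Γ₀) :
    HasOrderAt C.Γ₀ (f ∘ Subtype.val) x (∑ i ∈ Finset.Icc 1 a, circleOrder f (φ i) x) := by
  have hφ₀ : ∀ i : Finset.Icc 1 a, CircleParam (C.loop i) (L i) (φ i) :=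
    fun i => hφ i (C.Icc_chain_subset i.2)
  have hcover : CircleCover (fun i : Finset.Icc 1 a => (Subtype.val ⁻¹' C.loop i : Set C.Γ₀))
      (fun i => L i) (fun i t => ⟨φ i t, C.loop_subset i.2 ((hφ₀ i).mem t)⟩) :=
    { param := fun i => (hφ₀ i).codRestrict (C.loop_subset i.2)
      isClosed := fun i => (C.closedLoop i (C.Icc_chain_subset i.2)).preimage continuous_subtype_val
      exists_mem := fun y => by
        obtain ⟨i, hi, hy⟩ := C.exists_mem_loop₀ y.2
        exact ⟨⟨i, hi⟩, hy⟩
      inter := fun i j hij y hy z hz => Subtype.ext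
        (C.inter_subsingleton (C.Icc_chain_subset i.2) (C.Icc_chain_subset j.2)
          (fun h => hij (Subtype.ext h)) hy hz) }
  have := hcover.hasOrderAt (hf.comp_val C.Γ₀) x
  rw [Finset.sum_congr rfl fun i _ =>
    (hφ₀ i).circleOrder_codRestrict (C.loop_subset i.2) f x] at this
  rwa [← Finset.sum_coe_sort]

theorem exists_mem_loop_ne {j : ℕ} (hj : j ∈ Finset.Icc (a + 1) g) :
    ∃ x ∈ C.loop j, x ≠ C.v j := by
  obtain ⟨L, φ, hφ⟩ := C.circle j (Finset.Icc_subset_Icc_left (by omega) hj)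
  have hL := hφ.1
  obtain ⟨t, ht⟩ := hφ.exists_eq (mem_loop_v hj)
  refine ⟨φ (t + L / 2), hφ.mem _, fun h => ?_⟩
  have := hφ.eq_of_abs_sub_lt (h.trans ht.symm)
    (by rw [add_sub_cancel_left, abs_of_pos] <;> linarith)
  linarith

theorem circleOrder_eq_sum {f : C.Γ → ℝ}
    (hφ : ∀ i ∈ Finset.Icc 1 g, CircleParam (C.loop i) (L i) (φ i)) {j : ℕ}
    (hj : j ∈ Finset.Icc (a + 1) g) {x : C.Γ} (hx : x ∈ C.loop j) (hxv : x ≠ C.v j) :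
    ∑ i ∈ Finset.Icc 1 g, circleOrder f (φ i) x = circleOrder f (φ j) x := by
  refine Finset.sum_eq_single_of_mem j (Finset.Icc_subset_Icc_left (by omega) hj)
    fun i hi hij => (hφ i hi).circleOrder_of_notMem f fun hxi => hxv ?_
  rw [Finset.mem_Icc] at hi
  rcases le_or_gt i a with hia | hia
  · exact eq_v_of_mem hj hx (C.loop_subset (Finset.mem_Icc.2 ⟨hi.1, hia⟩) hxi)
  · have := C.attachDisj i (Finset.mem_Icc.2 ⟨hia, hi.2⟩) j hj hij
    exact absurd (this ▸ ⟨hxi, hx⟩ : x ∈ (∅ : Set C.Γ)) (Set.notMem_empty x)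

end ChainPlusLoops

/-- In the chain-plus-loops graph `Γ` : if `D` is an effective divisor of
degree `a + 2r` supported on `Γ₀` with `rk_Γ(D - P) = r` for some
`P ∈ γ_{a+1} \ {v_{a+1}}`, then `D` is linearly equivalent on `Γ₀` to
`2(v_{a+1} + ⋯ + v_{a+r+1}) + E` for some effective divisor `E` of degree `a - 2`
supported on `Γ₀`. -/
theorem statement10 (a g : ℕ) (C : ChainPlusLoops a g) (r : ℕ)
    (hr1 : 1 ≤ r) (hr2 : r + a + 2 ≤ g)
    (D : Divisor C.Γ) (hD : Effective D) (hs : ↑D.support ⊆ C.Γ₀)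
    (hdeg : divDeg D = (a : ℤ) + 2 * r)
    (P : C.Γ) (hP : P ∈ C.loop (a + 1)) (hPv : P ≠ C.v (a + 1))
    (hrank : divRank C.Γ (D - Finsupp.single P 1) = (r : ℤ)) :
    ∃ E : Divisor C.Γ, Effective E ∧ ↑E.support ⊆ C.Γ₀ ∧ divDeg E = (a : ℤ) - 2 ∧
      LinEquivOn C.Γ₀ D
        ((∑ i ∈ Finset.Icc (a + 1) (a + r + 1), Finsupp.single (C.v i) 2) + E) := by
  classical
  have hg := C.hg
  have : Nonempty C.Γ := ⟨P⟩
  choose! L φ hφ using C.circle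
  set J := Finset.Icc (a + 1) (a + r + 1) with hJ
  have hJg : J ⊆ Finset.Icc (a + 1) g := Finset.Icc_subset_Icc_right (by omega)
  obtain ⟨R, hRP, hR⟩ : ∃ R : ℕ → C.Γ, R (a + 1) = P ∧
      ∀ j ∈ Finset.Icc (a + 1) g, R j ∈ C.loop j ∧ R j ≠ C.v j := by
    choose! Q hQ using fun j (hj : j ∈ Finset.Icc (a + 1) g) =>
      ChainPlusLoops.exists_mem_loop_ne (C := C) hj
    refine ⟨Function.update Q (a + 1) P, Function.update_self _ _ _, fun j hj => ?_⟩
    by_cases h : j = a + 1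
    · subst h
      rw [Function.update_self]
      exact ⟨hP, hPv⟩
    · rw [Function.update_of_ne h]
      exact hQ j hj
  have hRΓ₀ : ∀ j ∈ Finset.Icc (a + 1) g, R j ∉ C.Γ₀ := fun j hj h =>
    (hR j hj).2 (ChainPlusLoops.eq_v_of_mem hj (hR j hj).1 h)
  have hDs : ∀ x ∉ C.Γ₀, D x = 0 := fun x hx => Finsupp.notMem_support_iff.1 fun h => hx (hs h)
  obtain ⟨F, hF, f, hf, hord⟩ := rankGE_of_divRank_eq hr1 hrank
    (∑ j ∈ Finset.Icc (a + 2) (a + r + 1), Finsupp.single (R j) 1)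
    (fun x => by
      rw [Finsupp.finsetSum_apply]
      exact Finset.sum_nonneg fun j _ => Finsupp.single_nonneg.2 zero_le_one x)
    (by
      rw [divDeg_eq_degree, map_sum]
      simp only [Finsupp.degree_single, Finset.sum_const, Nat.card_Icc, nsmul_eq_mul, mul_one]
      congr 1
      omega)
  have hdiv : ∀ x, ∑ i ∈ Finset.Icc 1 g, circleOrder f (φ i) x =
      F x - D x + ∑ j ∈ J, Finsupp.single (R j) (1 : ℤ) x := by
    intro x
    have hJins : J = insert (a + 1) (Finset.Icc (a + 2) (a + r + 1)) :=
      (Finset.insert_Icc_succ_left_eq_Icc (by omega)).symm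
    rw [(ChainPlusLoops.hasOrderAt hφ hf x).unique (hord x), hJins,
      Finset.sum_insert (by simp), hRP]
    simp only [Finsupp.sub_apply, Finsupp.finsetSum_apply]
    ring
  have hRnonneg : ∀ x, 0 ≤ ∑ j ∈ J, Finsupp.single (R j) (1 : ℤ) x := fun x =>
    Finset.sum_nonneg fun j _ => Finsupp.single_nonneg.2 zero_le_one x
  have hloop : ∀ j ∈ Finset.Icc (a + 1) g, circleOrder f (φ j) (C.v j) ≤ 0 ∧
      (j ∈ J → circleOrder f (φ j) (C.v j) ≤ -2) := by
    intro j hj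
    have hφj := hφ j (Finset.Icc_subset_Icc_left (by omega) hj)
    have hval : ∀ x ∈ C.loop j, x ≠ C.v j →
        circleOrder f (φ j) x = F x + ∑ j ∈ J, Finsupp.single (R j) (1 : ℤ) x := by
      intro x hx hxv
      rw [← ChainPlusLoops.circleOrder_eq_sum hφ hj hx hxv, hdiv,
        hDs x fun h => hxv (ChainPlusLoops.eq_v_of_mem hj hx h), sub_zero]
    have hnonneg : ∀ x ∈ C.loop j, x ≠ C.v j → 0 ≤ circleOrder f (φ j) x := fun x hx hxv => by
      rw [hval x hx hxv]
      exact add_nonneg (hF x) (hRnonneg x)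
    refine ⟨hφj.circleOrder_nonpos hf hnonneg, fun hjJ => ?_⟩
    refine hφj.circleOrder_le_neg_two hf (ChainPlusLoops.mem_loop_v hj) (hR j hj).1 (hR j hj).2
      ?_ hnonneg
    have hone : (1 : ℤ) ≤ ∑ i ∈ J, Finsupp.single (R i) (1 : ℤ) (R j) :=
      (by simp : (1 : ℤ) ≤ Finsupp.single (R j) (1 : ℤ) (R j)).trans
        (Finset.single_le_sum (f := fun i => Finsupp.single (R i) (1 : ℤ) (R j))
          (fun i _ => Finsupp.single_nonneg.2 zero_le_one _) hjJ)
    rw [hval _ (hR j hj).1 (hR j hj).2]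
    linarith [hF (R j)]
  set M : Divisor C.Γ := ∑ i : Finset.Icc 1 a,
    (hφ i (C.Icc_chain_subset i.2)).circleDiv hf with hM
  have hMapply : ∀ x, M x = ∑ i ∈ Finset.Icc 1 a, circleOrder f (φ i) x := fun x => by
    rw [hM, Finsupp.finsetSum_apply]
    exact Finset.sum_coe_sort (Finset.Icc 1 a) fun i => circleOrder f (φ i) x
  have hMdeg : M.degree = 0 := by
    rw [hM, map_sum]
    exact Finset.sum_eq_zero fun i _ => (hφ i (C.Icc_chain_subset i.2)).divDeg_circleDiv hf
  set V : Divisor C.Γ := ∑ i ∈ J, Finsupp.single (C.v i) 2 with hV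
  have hsplit : ∀ x ∈ C.Γ₀,
      D x + M x = F x - ∑ j ∈ Finset.Icc (a + 1) g, circleOrder f (φ j) x := by
    intro x hx
    have hsum : ∑ i ∈ Finset.Icc 1 g, circleOrder f (φ i) x =
        M x + ∑ j ∈ Finset.Icc (a + 1) g, circleOrder f (φ j) x := by
      rw [hMapply, ← Finset.sum_union]
      · congr 1
        ext i
        simp only [Finset.mem_union, Finset.mem_Icc]
        omega
      · rw [Finset.disjoint_left]
        intro i
        simp only [Finset.mem_Icc]
        omega
    have hRx : ∑ j ∈ J, Finsupp.single (R j) (1 : ℤ) x = 0 :=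
      Finset.sum_eq_zero fun j hj =>
        Finsupp.single_eq_of_ne fun h => hRΓ₀ j (hJg hj) (h ▸ hx)
    have := hdiv x
    rw [hsum, hRx] at this
    linarith
  have hzero : ∀ x ∉ C.Γ₀, (D + M - V) x = 0 := by
    intro x hx
    have hMx : M x = 0 := by
      rw [hMapply]
      exact Finset.sum_eq_zero fun i hi =>
        (hφ i (C.Icc_chain_subset hi)).circleOrder_of_notMem f fun h => hx (C.loop_subset hi h)
    have hVx : V x = 0 := by
      rw [hV, Finsupp.finsetSum_apply]
      exact Finset.sum_eq_zero fun j hj =>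
        Finsupp.single_eq_of_ne fun h => hx (h ▸ C.hvMem j (hJg hj))
    rw [Finsupp.sub_apply, Finsupp.add_apply, hDs x hx, hMx, hVx, add_zero, sub_zero]
  refine ⟨D + M - V, fun x => ?_, fun x hx => ?_, ?_, f ∘ Subtype.val, hf.comp_val _, fun x => ?_⟩
  · by_cases hx : x ∈ C.Γ₀
    · rw [Finsupp.sub_apply, Finsupp.add_apply, hsplit x hx, hV, Finsupp.finsetSum_apply]
      have hle : ∑ i ∈ J, Finsupp.single (C.v i) (2 : ℤ) x ≤
          ∑ j ∈ Finset.Icc (a + 1) g, -circleOrder f (φ j) x := by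
        have hterm : ∀ j ∈ Finset.Icc (a + 1) g, 0 ≤ -circleOrder f (φ j) x ∧
            (j ∈ J → Finsupp.single (C.v j) (2 : ℤ) x ≤ -circleOrder f (φ j) x) := by
          intro j hj
          by_cases hxv : x = C.v j
          · obtain ⟨h1, h2⟩ := hloop j hj
            rw [hxv, Finsupp.single_eq_same]
            exact ⟨by omega, fun hjJ => by have := h2 hjJ; omega⟩
          · rw [(hφ j (Finset.Icc_subset_Icc_left (by omega) hj)).circleOrder_of_notMem f
              fun h => hxv (ChainPlusLoops.eq_v_of_mem hj h hx), Finsupp.single_eq_of_ne hxv]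
            simp
        exact (Finset.sum_le_sum fun j hj => (hterm j (hJg hj)).2 hj).trans
          (Finset.sum_le_sum_of_subset_of_nonneg hJg fun j hj _ => (hterm j hj).1)
      rw [Finset.sum_neg_distrib] at hle
      linarith [hF x]
    · rw [hzero x hx]
  · by_contra hxΓ
    exact Finsupp.mem_support_iff.1 hx (hzero x hxΓ)
  · rw [divDeg_eq_degree] at hdeg ⊢
    rw [map_sub, map_add, hdeg, hMdeg, hV, map_sum]
    simp only [Finsupp.degree_single, Finset.sum_const, hJ, Nat.card_Icc, nsmul_eq_mul]
    rw [show a + r + 1 + 1 - (a + 1) = r + 1 by omega]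
    push_cast
    ring
  · have := ChainPlusLoops.hasOrderAt₀ hφ hf x
    rw [← hMapply] at this
    rw [add_sub_cancel]
    simpa [DivRestrict] using this
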